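/- For every nontrivial zero ρ of the Riemann zeta function, every real x > 0 and every positive integer l, δ_{l,ρ}(x) = −4π·((l+1/2)/x)³·∫₀¹ u^{2−ρ}·e^{−π((l+1/2)u/x)²} du. -/

import Mathlib

open MeasureTheory Real Filter

/-- The function `η(x) = 8πx²(πx² − 3/2)e^{−πx²}`. -/
noncomputable def eta (x : ℝ) : ℝ :=
  8 * π * x ^ 2 * (π * x ^ 2 - 3 / 2) * Real.exp (-π * x ^ 2)

/-- `g ρ = Z⁻¹ F_ρ`, given by `g ρ t = ∫₁^∞ η(u·t)·u^{ρ−1} du`. -/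
noncomputable def g (ρ : ℂ) (t : ℝ) : ℂ :=
  ∫ u in Set.Ioi (1 : ℝ), (eta (u * t) : ℂ) * (u : ℂ) ^ (ρ - 1)

/-- `F_ρ x = ∫₁^∞ (Σ_{n≥1} η(n·t·x))·t^{ρ−1} dt`. -/
noncomputable def F (ρ : ℂ) (x : ℝ) : ℂ :=
  ∫ t in Set.Ioi (1 : ℝ), (∑' n : ℕ, (eta (((n : ℝ) + 1) * t * x) : ℂ)) * (t : ℂ) ^ (ρ - 1)

/-- `δ_{l,ρ}(x) = ∫₀^∞ g ρ (x·t)·sin((2l+1)πt)/(πt) dt`. -/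
noncomputable def delta (l : ℕ) (ρ : ℂ) (x : ℝ) : ℂ :=
  ∫ t in Set.Ioi (0 : ℝ),
    g ρ (x * t) * ((Real.sin ((2 * (l : ℝ) + 1) * π * t) / (π * t) : ℝ) : ℂ)

/-- The Fourier transform `𝔉f(y) = ∫_ℝ f(x)·e^{2πixy} dx`. -/
noncomputable def FT (f : ℝ → ℂ) (y : ℝ) : ℂ :=
  ∫ x : ℝ, f x * Complex.exp (((2 * π * x * y : ℝ) : ℂ) * Complex.I)

theorem integrable_pow_mul_gaussian (n : ℕ) :
    Integrable fun s : ℝ => s ^ n * rexp (-π * s ^ 2) := by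
  have h := integrable_rpow_mul_exp_neg_mul_sq pi_pos (s := n)
    (by linarith [n.cast_nonneg (α := ℝ)])
  simpa only [rpow_natCast] using h

theorem tendsto_pow_mul_gaussian_atTop (n : ℕ) :
    Tendsto (fun s : ℝ => s ^ n * rexp (-π * s ^ 2)) atTop (nhds 0) := by
  have h := (tendsto_rpow_abs_mul_exp_neg_mul_sq_cocompact pi_pos n).mono_left atTop_le_cocompact
  refine h.congr' ?_
  filter_upwards [eventually_ge_atTop 0] with s hs
  rw [abs_of_nonneg hs, rpow_natCast]

theorem continuous_eta : Continuous eta := by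
  unfold eta
  fun_prop

theorem integrable_eta : Integrable eta := by
  have h := ((integrable_pow_mul_gaussian 4).const_mul (8 * π ^ 2)).sub
    ((integrable_pow_mul_gaussian 2).const_mul (12 * π))
  refine h.congr (ae_of_all _ fun s => ?_)
  simp only [eta, Pi.sub_apply]
  ring

theorem integrable_gaussian_mul_cos (w : ℝ) :
    Integrable fun s : ℝ => rexp (-π * s ^ 2) * cos (2 * π * w * s) := by
  refine ((integrable_pow_mul_gaussian 0).mul_bdd (c := 1)
    (g := fun s : ℝ => cos (2 * π * w * s)) (by fun_prop) ?_).congr ?_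
  · exact ae_of_all _ fun s => abs_cos_le_one _
  · exact ae_of_all _ fun s => by simp

theorem integral_gaussian_mul_cos (w : ℝ) :
    ∫ s in Set.Ioi (0 : ℝ), rexp (-π * s ^ 2) * cos (2 * π * w * s) =
      rexp (-π * w ^ 2) / 2 := by
  have hc := fourierIntegral_gaussian (b := π) (by simpa using pi_pos) (2 * π * w : ℝ)
  have hπ : (π : ℂ) ≠ 0 := by exact_mod_cast pi_ne_zero
  have hI : Integrable fun s : ℝ => Complex.exp (Complex.I * (2 * π * w : ℝ) * s) *
      Complex.exp (-π * (s : ℂ) ^ 2) := by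
    refine ((integrable_pow_mul_gaussian 0).ofReal (𝕜 := ℂ)).bdd_mul (c := 1)
      (f := fun s : ℝ => Complex.exp (Complex.I * (2 * π * w : ℝ) * s))
      (by fun_prop) (ae_of_all _ fun s => ?_) |>.congr (ae_of_all _ fun s => ?_)
    · rw [mul_assoc, ← Complex.ofReal_mul, mul_comm, Complex.norm_exp_ofReal_mul_I]
    · simp
  have hre := congrArg Complex.re hc
  rw [← Complex.reCLM_apply, ← ContinuousLinearMap.integral_comp_comm _ hI] at hre
  have hev := integral_comp_abs (f := fun s : ℝ => rexp (-π * s ^ 2) * cos (2 * π * w * s))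
  have hpt : ∀ s : ℝ, Complex.reCLM (Complex.exp (Complex.I * (2 * π * w : ℝ) * s) *
      Complex.exp (-π * (s : ℂ) ^ 2)) =
      rexp (-π * |s| ^ 2) * cos (2 * π * w * |s|) := fun s => by
    have h1 : Complex.exp (-π * (s : ℂ) ^ 2) = (rexp (-π * s ^ 2) : ℝ) := by push_cast; rfl
    have h2 : cos (2 * π * w * |s|) = cos (2 * π * w * s) := by
      rcases abs_choice s with h | h <;> rw [h]
      rw [mul_neg, cos_neg]
    rw [h1, h2, sq_abs, mul_assoc, ← Complex.ofReal_mul, mul_comm Complex.I, Complex.reCLM_apply,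
      Complex.re_mul_ofReal, Complex.exp_ofReal_mul_I_re, mul_comm]
  simp_rw [hpt] at hre
  rw [hev] at hre
  have hr : ((π / π : ℂ) ^ (1 / 2 : ℂ) * Complex.exp (-((2 * π * w : ℝ) : ℂ) ^ 2 / (4 * π))) =
      (rexp (-π * w ^ 2) : ℝ) := by
    rw [div_self hπ, Complex.one_cpow, one_mul, Complex.ofReal_exp]
    congr 1
    push_cast
    field_simp
    ring
  rw [hr, Complex.ofReal_re] at hre
  linarith

theorem hasDerivAt_gaussian_antideriv (w s : ℝ) :
    HasDerivAt (fun s : ℝ => rexp (-π * s ^ 2) *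
        ((4 * w ^ 2 + 2 / π - 4 * s ^ 2) * sin (2 * π * w * s) - 4 * w * s * cos (2 * π * w * s)))
      (8 * s * (π * s ^ 2 - 3 / 2) * rexp (-π * s ^ 2) * sin (2 * π * w * s) +
        8 * π * w ^ 3 * (rexp (-π * s ^ 2) * cos (2 * π * w * s))) s := by
  have he : HasDerivAt (fun s : ℝ => rexp (-π * s ^ 2)) (rexp (-π * s ^ 2) * (-π * (2 * s))) s := by
    simpa using ((hasDerivAt_pow 2 s).const_mul (-π)).exp
  have hl : HasDerivAt (fun s : ℝ => 2 * π * w * s) (2 * π * w) s := by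
    simpa using (hasDerivAt_id s).const_mul (2 * π * w)
  have hp : HasDerivAt (fun s : ℝ => 4 * w ^ 2 + 2 / π - 4 * s ^ 2) (-(4 * (2 * s))) s := by
    simpa using ((hasDerivAt_pow 2 s).const_mul 4).const_sub (4 * w ^ 2 + 2 / π)
  have hq : HasDerivAt (fun s : ℝ => 4 * w * s) (4 * w) s := by
    simpa using (hasDerivAt_id s).const_mul (4 * w)
  refine (he.mul ((hp.mul hl.sin).sub (hq.mul hl.cos))).congr_deriv ?_
  simp only [Pi.mul_apply, Pi.sub_apply]
  field_simp
  ring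

theorem integrable_odd_gaussian_mul_sin (w : ℝ) :
    Integrable fun s : ℝ =>
      8 * s * (π * s ^ 2 - 3 / 2) * rexp (-π * s ^ 2) * sin (2 * π * w * s) := by
  have h := ((integrable_pow_mul_gaussian 3).const_mul (8 * π)).sub
    ((integrable_pow_mul_gaussian 1).const_mul 12)
  refine (h.mul_bdd (c := 1) (g := fun s : ℝ => sin (2 * π * w * s)) (by fun_prop)
    (ae_of_all _ fun s => abs_sin_le_one _)).congr (ae_of_all _ fun s => ?_)
  simp only [Pi.sub_apply]
  ring

theorem integral_odd_gaussian_mul_sin (w : ℝ) :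
    ∫ s in Set.Ioi (0 : ℝ),
      8 * s * (π * s ^ 2 - 3 / 2) * rexp (-π * s ^ 2) * sin (2 * π * w * s) =
      -4 * π * w ^ 3 * rexp (-π * w ^ 2) := by
  have hsin := (integrable_odd_gaussian_mul_sin w).integrableOn (s := Set.Ioi 0)
  have hcos := ((integrable_gaussian_mul_cos w).const_mul (8 * π * w ^ 3)).integrableOn
    (s := Set.Ioi 0)
  have hlim : Tendsto (fun s : ℝ => rexp (-π * s ^ 2) *
      ((4 * w ^ 2 + 2 / π - 4 * s ^ 2) * sin (2 * π * w * s) - 4 * w * s * cos (2 * π * w * s)))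
      atTop (nhds 0) := by
    have hb : Tendsto (fun s : ℝ => |4 * w ^ 2 + 2 / π| * (s ^ 0 * rexp (-π * s ^ 2)) +
        4 * (s ^ 2 * rexp (-π * s ^ 2)) + |4 * w| * (s ^ 1 * rexp (-π * s ^ 2)))
        atTop (nhds 0) := by
      simpa using (((tendsto_pow_mul_gaussian_atTop 0).const_mul _).add
        ((tendsto_pow_mul_gaussian_atTop 2).const_mul _)).add
        ((tendsto_pow_mul_gaussian_atTop 1).const_mul _)
    refine squeeze_zero_norm' ?_ hb
    filter_upwards [eventually_ge_atTop 0] with s hs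
    have h1 : |(4 * w ^ 2 + 2 / π - 4 * s ^ 2) * sin (2 * π * w * s)| ≤
        |4 * w ^ 2 + 2 / π| + 4 * s ^ 2 := by
      rw [abs_mul]
      refine (mul_le_of_le_one_right (abs_nonneg _) (abs_sin_le_one _)).trans ?_
      refine (abs_sub _ _).trans ?_
      rw [abs_of_nonneg (by positivity : 0 ≤ 4 * s ^ 2)]
    have h2 : |4 * w * s * cos (2 * π * w * s)| ≤ |4 * w| * s := by
      rw [abs_mul, abs_mul _ s, abs_of_nonneg hs]
      exact mul_le_of_le_one_right (by positivity) (abs_cos_le_one _)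
    rw [norm_mul, norm_eq_abs, norm_eq_abs, abs_of_pos (exp_pos _)]
    calc _ ≤ rexp (-π * s ^ 2) * (|4 * w ^ 2 + 2 / π| + 4 * s ^ 2 + |4 * w| * s) := by
          gcongr
          exact (abs_sub _ _).trans (add_le_add h1 h2)
      _ = _ := by ring
  have hFTC := integral_Ioi_of_hasDerivAt_of_tendsto (a := 0)
    (hasDerivAt_gaussian_antideriv w 0).continuousAt.continuousWithinAt
    (fun s _ => hasDerivAt_gaussian_antideriv w s) (hsin.add hcos) hlim
  rw [integral_add hsin hcos, integral_const_mul, integral_gaussian_mul_cos] at hFTC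
  simp only [mul_zero, sin_zero] at hFTC
  linarith

theorem integral_eta_mul_sinc {a : ℝ} (ha : 0 < a) (L : ℝ) :
    ∫ t in Set.Ioi (0 : ℝ), eta (a * t) * (sin (2 * L * π * t) / (π * t)) =
      -4 * π * (L / a) ^ 3 * rexp (-π * (L / a) ^ 2) := by
  have h := integral_comp_mul_left_Ioi (fun s : ℝ =>
    8 * s * (π * s ^ 2 - 3 / 2) * rexp (-π * s ^ 2) * sin (2 * π * (L / a) * s)) 0 ha
  rw [mul_zero, integral_odd_gaussian_mul_sin, smul_eq_mul, eq_inv_mul_iff_mul_eq₀ ha.ne',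
    ← integral_const_mul] at h
  rw [← h]
  refine setIntegral_congr_fun measurableSet_Ioi fun t ht => ?_
  have ht : t ≠ 0 := ne_of_gt ht
  have harg : 2 * π * (L / a) * (a * t) = 2 * L * π * t := by field_simp
  simp only [eta, harg]
  field_simp

theorem integrable_rpow_mul_eta {σ x : ℝ} (hσ : σ < 1) (hx : 0 < x) :
    Integrable (fun p : ℝ × ℝ => p.1 ^ (σ - 1) * eta (p.1 * (x * p.2)))
      ((volume.restrict (Set.Ioi 1)).prod (volume.restrict (Set.Ioi 0))) := by
  have hmeas : Measurable fun p : ℝ × ℝ => p.1 ^ (σ - 1) * eta (p.1 * (x * p.2)) :=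
    (measurable_fst.pow_const _).mul (continuous_eta.measurable.comp (by fun_prop))
  refine (integrable_prod_iff hmeas.aestronglyMeasurable).2 ⟨?_, ?_⟩
  · filter_upwards [ae_restrict_mem measurableSet_Ioi] with u hu
    have hux : 0 < u * x := mul_pos (zero_lt_one.trans hu) hx
    simp_rw [← mul_assoc u x]
    refine Integrable.const_mul ?_ _
    exact (integrableOn_Ioi_comp_mul_left_iff eta 0 hux).2 integrable_eta.integrableOn
  · have hI : IntegrableOn (fun u : ℝ => (x⁻¹ * ∫ s in Set.Ioi (0 : ℝ), |eta s|) * u ^ (σ - 2))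
        (Set.Ioi 1) :=
      (integrableOn_Ioi_rpow_of_lt (by linarith) one_pos).const_mul _
    refine hI.congr ?_
    filter_upwards [ae_restrict_mem measurableSet_Ioi] with u hu
    have hu0 : 0 < u := zero_lt_one.trans hu
    have hscale := integral_comp_mul_left_Ioi (fun s => |eta s|) 0 (mul_pos hu0 hx)
    simp_rw [norm_mul, norm_eq_abs, abs_of_pos (rpow_pos_of_pos hu0 _), ← mul_assoc u x]
    rw [integral_const_mul, hscale, mul_zero, smul_eq_mul,
      show σ - 2 = σ - 1 - 1 by ring, rpow_sub_one hu0.ne', mul_inv]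
    field_simp

theorem integrable_eta_mul_cpow_mul_sinc {ρ : ℂ} (hρ : ρ.re < 1) {x : ℝ} (hx : 0 < x) (L : ℝ) :
    Integrable (Function.uncurry fun u t : ℝ => (eta (u * (x * t)) : ℂ) * (u : ℂ) ^ (ρ - 1) *
        ((sin (2 * L * π * t) / (π * t) : ℝ) : ℂ))
      ((volume.restrict (Set.Ioi 1)).prod (volume.restrict (Set.Ioi 0))) := by
  have hmeas : Measurable (Function.uncurry fun u t : ℝ =>
      (eta (u * (x * t)) : ℂ) * (u : ℂ) ^ (ρ - 1) *
        ((sin (2 * L * π * t) / (π * t) : ℝ) : ℂ)) := by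
    have h1 : Measurable fun p : ℝ × ℝ => eta (p.1 * (x * p.2)) :=
      continuous_eta.measurable.comp (by fun_prop)
    have h2 : Measurable fun p : ℝ × ℝ => (p.1 : ℂ) ^ (ρ - 1) :=
      (Complex.measurable_ofReal.comp measurable_fst).pow_const _
    have h3 : Measurable fun p : ℝ × ℝ => sin (2 * L * π * p.2) / (π * p.2) := by fun_prop
    exact ((Complex.measurable_ofReal.comp h1).mul h2).mul (Complex.measurable_ofReal.comp h3)
  refine ((integrable_rpow_mul_eta hρ hx).norm.const_mul |2 * L|).mono'
    hmeas.aestronglyMeasurable ?_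
  rw [Measure.prod_restrict]
  filter_upwards [ae_restrict_mem (measurableSet_Ioi.prod measurableSet_Ioi)] with p hp
  obtain ⟨u, t⟩ := p
  have hu0 : 0 < u := zero_lt_one.trans hp.1
  have ht0 : 0 < t := hp.2
  have hsinc : |sin (2 * L * π * t) / (π * t)| ≤ |2 * L| := by
    rw [abs_div, abs_of_pos (mul_pos pi_pos ht0), div_le_iff₀ (mul_pos pi_pos ht0)]
    refine (abs_sin_le_abs).trans_eq ?_
    rw [mul_assoc, abs_mul, abs_of_pos (mul_pos pi_pos ht0)]
  simp only [Function.uncurry_apply_pair, norm_mul, Complex.norm_real, norm_eq_abs,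
    Complex.norm_cpow_eq_rpow_re_of_pos hu0, Complex.sub_re, Complex.one_re,
    abs_of_pos (rpow_pos_of_pos hu0 _)]
  calc _ ≤ |eta (u * (x * t))| * u ^ (ρ.re - 1) * |2 * L| := by gcongr
    _ = _ := by ring

theorem intervalIntegral_zero_one_eq_integral_Ioi_inv (f : ℝ → ℂ) :
    ∫ v in (0 : ℝ)..1, f v = ∫ u in Set.Ioi (1 : ℝ), ((u ^ 2)⁻¹ : ℝ) • f u⁻¹ := by
  have himage : (fun u : ℝ => u⁻¹) '' Set.Ioi 1 = Set.Ioo 0 1 := by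
    have h := Set.inv_Ioi₀ (zero_lt_one' ℝ)
    rwa [← Set.image_inv_eq_inv, inv_one] at h
  rw [intervalIntegral.integral_of_le zero_le_one, integral_Ioc_eq_integral_Ioo, ← himage,
    integral_image_eq_integral_abs_deriv_smul (f' := fun u => -(u ^ 2)⁻¹) measurableSet_Ioi
      (fun u hu => (hasDerivAt_inv (zero_lt_one.trans hu).ne').hasDerivWithinAt)
      inv_injective.injOn]
  simp only [abs_neg, abs_inv, abs_pow, sq_abs]

theorem stmt_1 (ρ : ℂ) (hζ : riemannZeta ρ = 0) (hρ0 : 0 < ρ.re) (hρ1 : ρ.re < 1)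
    (x : ℝ) (hx : 0 < x) (l : ℕ) (hl : 0 < l) :
    delta l ρ x =
      -4 * (π : ℂ) * ((((l : ℝ) + 1 / 2) / x : ℝ) : ℂ) ^ 3 *
        ∫ u in (0 : ℝ)..1,
          (u : ℂ) ^ (2 - ρ) * (Real.exp (-π * ((((l : ℝ) + 1 / 2) / x) * u) ^ 2) : ℂ) := by
  set L : ℝ := (l : ℝ) + 1 / 2 with hL
  have hfreq : 2 * (l : ℝ) + 1 = 2 * L := by rw [hL]; ring
  unfold delta g
  simp_rw [hfreq, ← integral_mul_const]
  rw [← integral_integral_swap (integrable_eta_mul_cpow_mul_sinc hρ1 hx L),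
    intervalIntegral_zero_one_eq_integral_Ioi_inv, ← integral_const_mul]
  refine setIntegral_congr_fun measurableSet_Ioi fun u hu => ?_
  have hu0 : 0 < u := zero_lt_one.trans hu
  have huC : (u : ℂ) ≠ 0 := by exact_mod_cast hu0.ne'
  have hxC : (x : ℂ) ≠ 0 := by exact_mod_cast hx.ne'
  have hinner := congrArg (Complex.ofReal) (integral_eta_mul_sinc (mul_pos hu0 hx) L)
  rw [← integral_complex_ofReal] at hinner
  have hpow : ((u⁻¹ : ℝ) : ℂ) ^ (2 - ρ) = (u : ℂ) ^ (ρ - 1) * (u : ℂ)⁻¹ := by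
    rw [Complex.ofReal_inv, Complex.inv_cpow _ _ (by
      rw [Complex.arg_ofReal_of_nonneg hu0.le]; exact pi_ne_zero.symm), ← Complex.cpow_neg,
      ← Complex.cpow_neg_one, ← Complex.cpow_add _ _ huC]
    congr 1
    ring
  calc _ = (u : ℂ) ^ (ρ - 1) * ∫ t in Set.Ioi (0 : ℝ),
        ((eta (u * x * t) * (sin (2 * L * π * t) / (π * t)) : ℝ) : ℂ) := by
        rw [← integral_const_mul]
        refine integral_congr_ae (ae_of_all _ fun t => ?_)
        simp only [mul_assoc u x, Complex.ofReal_mul]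
        ring
    _ = _ := by
        have harg : L / x * u⁻¹ = L / (u * x) := by field_simp
        rw [hinner, hpow, harg, Complex.real_smul]
        push_cast
        field_simp
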